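/- Let L ⊆ ℝ² be a compact set such that ℝ² ∖ L is connected. Then L has arbitrarily small neighbourhoods that are finite unions of disjoint compact disks: for every open set V with L ⊆ V there exists a set E with L ⊆ interior(E) ⊆ E ⊆ V such that E is the union of finitely many pairwise disjoint sets, each homeomorphic to the closed unit disk {x ∈ ℝ² : ‖x‖ ≤ 1}. -/

import Mathlib

open Set

noncomputable section

/-- Euclidean 2-space (the plane). -/
abbrev R2 := EuclideanSpace ℝ (Fin 2)

/-- The factor by which the radial push moves a point with gauges `p`, `q` and cutoff `c`. -/
def pushFactor (p q c : ℝ) : ℝ := 1 + max 0 ((1 - c) / (max p 1 - c)) * (p / q - 1)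

lemma pushFactor_of_one_le {p q c : ℝ} (hcp : c < p) (hc : 1 ≤ c) : pushFactor p q c = 1 := by
  have : (1 - c) / (max p 1 - c) ≤ 0 :=
    div_nonpos_of_nonpos_of_nonneg (by linarith) (by linarith [le_max_left p 1])
  simp [pushFactor, max_eq_left this]

lemma pushFactor_of_le_one {p q c : ℝ} (hp : p ≤ 1) (hc : c < 1) : pushFactor p q c = p / q := by
  rw [pushFactor, max_eq_right hp, div_self (by linarith), max_eq_right zero_le_one]
  ring

lemma pushFactor_of_one_lt {p q c : ℝ} (hp : 1 < p) (hc : c < 1) :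
    pushFactor p q c = 1 + (1 - c) / (p - c) * (p / q - 1) := by
  rw [pushFactor, max_eq_left hp.le, max_eq_right]
  exact div_nonneg (by linarith) (by linarith)

lemma pushFactor_self {p c : ℝ} (hp : p ≠ 0) : pushFactor p p c = 1 := by
  simp [pushFactor, div_self hp]

lemma pushFactor_pos {p q c : ℝ} (hq : 0 < q) (hc : 0 ≤ c) (hcp : c < p) :
    0 < pushFactor p q c := by
  rcases le_or_gt 1 c with h1 | h1
  · rw [pushFactor_of_one_le hcp h1]; exact one_pos
  rcases le_or_gt p 1 with hp | hp
  · rw [pushFactor_of_le_one hp h1]; exact div_pos (hc.trans_lt hcp) hq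
  · rw [pushFactor_of_one_lt hp h1]
    have h2 : (1 - c) / (p - c) < 1 := (div_lt_one (by linarith)).2 (by linarith)
    have h3 : 0 < (1 - c) / (p - c) := div_pos (by linarith) (by linarith)
    have h4 : 0 < p / q := div_pos (by linarith) hq
    nlinarith

lemma pushFactor_mul_lt_one {p q c : ℝ} (hc : 0 ≤ c) (hcp : c < p) (hcq : c < q) (h1 : c < 1) :
    pushFactor p q c * c < 1 := by
  have hq : 0 < q := hc.trans_lt hcq
  rcases le_or_gt p 1 with hp | hp
  · rw [pushFactor_of_le_one hp h1, div_mul_eq_mul_div, div_lt_one hq]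
    nlinarith
  · rw [pushFactor_of_one_lt hp h1]
    have h : 1 + (1 - c) / (p - c) * (p / q - 1)
        = (q * (p - c) + (1 - c) * (p - q)) / (q * (p - c)) := by
      have : p - c ≠ 0 := by linarith
      field_simp
    rw [h, div_mul_eq_mul_div, div_lt_one (by nlinarith)]
    have : 0 < (q - c) * (p - c) * (1 - c) := by
      apply mul_pos (mul_pos _ _) <;> linarith
    nlinarith [mul_pos (sub_pos.2 hcq) (sub_pos.2 hcp)]

lemma pushFactor_mul_le_one_iff {p q c : ℝ} (hc : 0 ≤ c) (hcq : c < q) (h1 : c < 1) :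
    pushFactor p q c * q ≤ 1 ↔ p ≤ 1 := by
  have hq : 0 < q := hc.trans_lt hcq
  rcases le_or_gt p 1 with hp | hp
  · rw [pushFactor_of_le_one hp h1, div_mul_cancel₀ _ hq.ne']
  · simp only [hp.not_ge, iff_false, not_le]
    rw [pushFactor_of_one_lt hp h1]
    have h : (1 + (1 - c) / (p - c) * (p / q - 1)) * q
        = (q * (p - c) + (1 - c) * (p - q)) / (p - c) := by
      have : p - c ≠ 0 := by linarith
      field_simp
    rw [h, one_lt_div (by linarith)]
    nlinarith [mul_pos (sub_pos.2 hcq) (sub_pos.2 hp)]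

lemma pushFactor_mul_pushFactor {p q c : ℝ} (hc : 0 ≤ c) (hcp : c < p) (hcq : c < q) :
    pushFactor (pushFactor p q c * q) (pushFactor p q c * p) (pushFactor p q c * c)
      * pushFactor p q c = 1 := by
  have hq : 0 < q := hc.trans_lt hcq
  have hp0 : 0 < p := hc.trans_lt hcp
  have hs := pushFactor_pos hq hc hcp
  rcases le_or_gt 1 c with h1 | h1
  · rw [pushFactor_of_one_le hcp h1]
    simp [pushFactor_of_one_le hcq h1]
  have hc' := pushFactor_mul_lt_one hc hcp hcq h1
  have hiff := pushFactor_mul_le_one_iff (p := p) hc hcq h1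
  rcases le_or_gt p 1 with hp | hp
  · rw [pushFactor_of_le_one (hiff.2 hp) hc', pushFactor_of_le_one hp h1]
    field_simp
  · rw [pushFactor_of_one_lt (lt_of_not_ge fun h => hp.not_ge (hiff.1 h)) hc']
    set s := pushFactor p q c with hsdef
    have hs' : s * (q * (p - c)) = q * (p - c) + (1 - c) * (p - q) := by
      rw [hsdef, pushFactor_of_one_lt hp h1]
      have : p - c ≠ 0 := by linarith
      field_simp
    have h3 : q - c ≠ 0 := by linarith
    have h5 : s * q - s * c ≠ 0 := by
      rw [← mul_sub]; exact mul_ne_zero hs.ne' h3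
    field_simp
    linear_combination hs'
open Topology Bornology

section RadialPush

variable {X : Type*} [NormedAddCommGroup X] [NormedSpace ℝ X]

/-- Rescale `x` so that its gauge with respect to `T` becomes its gauge with respect to `S` as long
as it is in `S`, tapering off to the identity where `t * gauge B x = 1`. -/
def radialPush (S T B : Set X) (t : ℝ) (x : X) : X :=
  pushFactor (gauge S x) (gauge T x) (t * gauge B x) • x

/-- A bounded convex neighbourhood of the origin. -/
structure IsConvexBody (S : Set X) : Prop where
  convex : Convex ℝ S
  mem_nhds : S ∈ 𝓝 0
  isBounded : IsBounded S

lemma IsConvexBody.gauge_pos {S : Set X} (hS : IsConvexBody S) {x : X} (hx : x ≠ 0) :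
    0 < gauge S x :=
  (_root_.gauge_pos (absorbent_nhds_zero hS.mem_nhds)
    (NormedSpace.isVonNBounded_of_isBounded ℝ hS.isBounded)).2 hx

lemma mul_gauge_lt {S B : Set X} (hS : IsConvexBody S) (hB : IsConvexBody B) (hSB : S ⊆ B) {t : ℝ}
    (ht : t < 1) {x : X} (hx : x ≠ 0) : t * gauge B x < gauge S x := by
  have h1 := gauge_mono (absorbent_nhds_zero hS.mem_nhds) hSB x
  have h2 := hB.gauge_pos hx
  nlinarith

lemma continuous_radialPush {S T B : Set X} (hS : IsConvexBody S) (hT : IsConvexBody T)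
    (hB : IsConvexBody B) (hSB : S ⊆ B) {t : ℝ} (ht : t < 1) :
    Continuous (radialPush S T B t) := by
  have key : radialPush S T B t = fun x =>
      x + max 0 ((1 - t * gauge B x) / (max (gauge S x) 1 - t * gauge B x)) •
        (gaugeRescale S T x - x) := by
    funext x
    simp only [radialPush, pushFactor, gaugeRescale]
    module
  rw [key]
  have h1 := continuous_gaugeRescale hS.convex hS.mem_nhds hT.convex hT.mem_nhds
    (NormedSpace.isVonNBounded_of_isBounded ℝ hT.isBounded)
  have h2 := continuous_gauge hB.convex hB.mem_nhds
  have h3 := continuous_gauge hS.convex hS.mem_nhds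
  refine continuous_id.add (Continuous.smul (continuous_const.max (Continuous.div (by fun_prop)
    (by fun_prop) fun x => ?_)) (h1.sub continuous_id))
  rcases eq_or_ne x 0 with rfl | hx
  · simp
  · have := mul_gauge_lt hS hB hSB ht hx
    rcases le_or_gt (gauge S x) 1 with h | h
    · rw [max_eq_right h]
      have := this.trans_le h
      linarith
    · rw [max_eq_left h.le]; linarith

lemma radialPush_zero (S T B : Set X) (t : ℝ) : radialPush S T B t 0 = 0 := by simp [radialPush]

lemma pushFactor_gauge_pos {S T B : Set X} (hS : IsConvexBody S) (hT : IsConvexBody T)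
    (hB : IsConvexBody B) (hSB : S ⊆ B) {t : ℝ} (ht0 : 0 ≤ t) (ht : t < 1) {x : X} (hx : x ≠ 0) :
    0 < pushFactor (gauge S x) (gauge T x) (t * gauge B x) :=
  pushFactor_pos (hT.gauge_pos hx) (mul_nonneg ht0 (gauge_nonneg _)) (mul_gauge_lt hS hB hSB ht hx)

lemma gauge_radialPush {S T B : Set X} (hS : IsConvexBody S) (hT : IsConvexBody T)
    (hB : IsConvexBody B) (hSB : S ⊆ B) {t : ℝ} (ht0 : 0 ≤ t) (ht : t < 1) {x : X} (hx : x ≠ 0)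
    (U : Set X) : gauge U (radialPush S T B t x) =
      pushFactor (gauge S x) (gauge T x) (t * gauge B x) * gauge U x := by
  rw [radialPush, gauge_smul_of_nonneg (pushFactor_gauge_pos hS hT hB hSB ht0 ht hx).le,
    smul_eq_mul]

lemma radialPush_radialPush {S T B : Set X} (hS : IsConvexBody S) (hT : IsConvexBody T)
    (hB : IsConvexBody B) (hSB : S ⊆ B) (hTB : T ⊆ B) {t : ℝ} (ht0 : 0 ≤ t) (ht : t < 1) (x : X) :
    radialPush T S B t (radialPush S T B t x) = x := by
  rcases eq_or_ne x 0 with rfl | hx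
  · simp [radialPush_zero]
  conv_lhs => rw [radialPush]
  simp only [gauge_radialPush hS hT hB hSB ht0 ht hx]
  rw [radialPush, smul_smul, mul_left_comm t, pushFactor_mul_pushFactor
    (mul_nonneg ht0 (gauge_nonneg _)) (mul_gauge_lt hS hB hSB ht hx)
    (mul_gauge_lt hT hB hTB ht hx), one_smul]

/-- The radial push as a homeomorphism. -/
def radialPushHomeomorph {S T B : Set X} (hS : IsConvexBody S) (hT : IsConvexBody T)
    (hB : IsConvexBody B) (hSB : S ⊆ B) (hTB : T ⊆ B) {t : ℝ} (ht0 : 0 ≤ t) (ht : t < 1) :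
    X ≃ₜ X where
  toFun := radialPush S T B t
  invFun := radialPush T S B t
  left_inv := radialPush_radialPush hS hT hB hSB hTB ht0 ht
  right_inv := radialPush_radialPush hT hS hB hTB hSB ht0 ht
  continuous_toFun := continuous_radialPush hS hT hB hSB ht
  continuous_invFun := continuous_radialPush hT hS hB hTB ht

lemma gauge_le_one_iff_mem {S : Set X} (hS : Convex ℝ S) (hS0 : S ∈ 𝓝 0) (hc : IsClosed S)
    {x : X} : gauge S x ≤ 1 ↔ x ∈ S := by
  rw [gauge_le_one_iff_mem_closure hS hS0, hc.closure_eq]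

lemma gauge_inter_eq_max {A B : Set X} (hA : Convex ℝ A) (hA0 : A ∈ 𝓝 0) (hAc : IsClosed A)
    (hB : Convex ℝ B) (hB0 : B ∈ 𝓝 0) (hBc : IsClosed B) (x : X) :
    gauge (A ∩ B) x = max (gauge A x) (gauge B x) := by
  have hD := absorbent_nhds_zero (𝕜 := ℝ) (Filter.inter_mem hA0 hB0)
  refine le_antisymm (le_of_forall_gt_imp_ge_of_dense fun r hr => ?_)
    (max_le (gauge_mono hD inter_subset_left x) (gauge_mono hD inter_subset_right x))
  obtain ⟨h1, h2⟩ := max_lt_iff.1 hr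
  have hr0 : 0 < r := (gauge_nonneg _).trans_lt h1
  have h : gauge (A ∩ B) (r⁻¹ • x) ≤ 1 := by
    refine gauge_le_one_of_mem ⟨(gauge_le_one_iff_mem hA hA0 hAc).1 ?_,
      (gauge_le_one_iff_mem hB hB0 hBc).1 ?_⟩ <;>
    · rw [gauge_smul_of_nonneg (by positivity), smul_eq_mul, inv_mul_le_iff₀ hr0]
      linarith
  rwa [gauge_smul_of_nonneg (by positivity), smul_eq_mul, inv_mul_le_iff₀ hr0, mul_one] at h

lemma exists_homeomorph_image_eq_union_of_mem_nhds_zero {A B E : Set X} (hA : Convex ℝ A)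
    (hAc : IsClosed A) (hA0 : A ∈ 𝓝 0) (hB : IsConvexBody B) (hBc : IsClosed B) {η : ℝ} (hη : 0 < η)
    (hE : ∀ z ∈ Metric.thickening η B, z ∈ E ↔ z ∈ A) : ∃ h : X ≃ₜ X, h '' E = E ∪ B := by
  obtain ⟨M, hM0, hM⟩ : ∃ M > 0, ∀ x ∈ B, ‖x‖ < M := by
    obtain ⟨M, hM0, hM⟩ := hB.isBounded.exists_pos_norm_lt
    exact ⟨M, hM0, hM⟩
  set t : ℝ := M / (M + η) with ht_def
  have ht0 : 0 < t := by positivity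
  have ht1 : t < 1 := (div_lt_one (by positivity)).2 (by linarith)
  have hc : ∀ z, t * gauge B z < 1 → z ∈ Metric.thickening η B := by
    intro z hz
    have hzB : t • z ∈ B := by
      rw [← gauge_le_one_iff_mem hB.convex hB.mem_nhds hBc, gauge_smul_of_nonneg ht0.le,
        smul_eq_mul]
      exact hz.le
    refine Metric.mem_thickening_iff.2 ⟨t • z, hzB, ?_⟩
    have h1 := hM _ hzB
    rw [norm_smul, Real.norm_of_nonneg ht0.le] at h1
    rw [dist_eq_norm, show z - t • z = (1 - t) • z by module, norm_smul,
      Real.norm_of_nonneg (by linarith)]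
    have h2 : 1 - t = t * (η / M) := by rw [ht_def]; field_simp; ring
    calc (1 - t) * ‖z‖ = η / M * (t * ‖z‖) := by rw [h2]; ring
      _ < η / M * M := by gcongr
      _ = η := by field_simp
  have hD : IsConvexBody (A ∩ B) := ⟨hA.inter hB.convex, Filter.inter_mem hA0 hB.mem_nhds,
    hB.isBounded.subset inter_subset_right⟩
  let h := radialPushHomeomorph hD hB hB inter_subset_right subset_rfl ht0.le ht1
  have hmem : ∀ z, h z ∈ E ∪ B ↔ z ∈ E := by
    intro z
    have hE' : ∀ z, t * gauge B z < 1 → (z ∈ E ↔ gauge A z ≤ 1) := fun z hz => by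
      rw [hE z (hc z hz), gauge_le_one_iff_mem hA hA0 hAc]
    have hBm : ∀ z, z ∈ B ↔ gauge B z ≤ 1 := fun z =>
      (gauge_le_one_iff_mem hB.convex hB.mem_nhds hBc).symm
    change radialPush (A ∩ B) B B t z ∈ E ∪ B ↔ z ∈ E
    rcases eq_or_ne z 0 with rfl | hz
    · rw [radialPush_zero, mem_union, hE' 0 (by simp)]
      simp [mem_of_mem_nhds hB.mem_nhds]
    have hb := hB.gauge_pos hz
    have hcd := mul_gauge_lt hD hB inter_subset_right ht1 hz
    have hcb : t * gauge B z < gauge B z := by nlinarith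
    have hc0 : 0 ≤ t * gauge B z := by positivity
    rcases le_or_gt 1 (t * gauge B z) with h1 | h1
    · rw [radialPush, pushFactor_of_one_le hcd h1, one_smul, mem_union, hBm, or_iff_left]
      linarith
    have hpos := pushFactor_gauge_pos hD hB hB inter_subset_right ht0.le ht1 hz
    have hg := gauge_radialPush hD hB hB inter_subset_right ht0.le ht1 hz
    have hdb := gauge_inter_eq_max hA hA0 hAc hB.convex hB.mem_nhds hBc z
    have hc1 : t * gauge B (radialPush (A ∩ B) B B t z) < 1 := by
      rw [hg, mul_left_comm]
      exact pushFactor_mul_lt_one hc0 hcd hcb h1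
    rw [mem_union, hE' _ hc1, hE' _ h1, hBm, hg, hg]
    rcases le_or_gt (gauge A z) (gauge B z) with hab | hab
    · rw [hdb, max_eq_right hab, pushFactor_self hb.ne', one_mul, one_mul, or_iff_left_of_imp]
      exact hab.trans
    · rw [or_iff_right_of_imp, pushFactor_mul_le_one_iff hc0 hcb h1, hdb, max_eq_left hab.le]
      exact fun h => (mul_le_mul_of_nonneg_left hab.le hpos.le).trans h
  refine ⟨h, ?_⟩
  ext z
  rw [← h.apply_symm_apply z, hmem, h.injective.mem_set_image]

/-- If near a closed bounded convex set `B` the set `E` agrees with a closed convex set `A` whose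
interior meets that of `B`, then `E` and `E ∪ B` are ambiently homeomorphic. -/
lemma exists_homeomorph_image_eq_union {A B E : Set X} (hA : Convex ℝ A) (hAc : IsClosed A)
    (hB : Convex ℝ B) (hBc : IsClosed B) (hBb : IsBounded B)
    (hAB : (interior A ∩ interior B).Nonempty) {η : ℝ} (hη : 0 < η)
    (hE : ∀ z ∈ Metric.thickening η B, z ∈ E ↔ z ∈ A) : ∃ h : X ≃ₜ X, h '' E = E ∪ B := by
  obtain ⟨o, hoA, hoB⟩ := hAB
  let τ : X ≃ₜ X := Homeomorph.addLeft o
  have hτ : Continuous τ := τ.continuous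
  have hnhds : ∀ {S : Set X}, o ∈ interior S → τ ⁻¹' S ∈ 𝓝 0 := fun {S} hS =>
    hτ.continuousAt.preimage_mem_nhds (by simpa [τ, mem_interior_iff_mem_nhds] using hS)
  have hbdd : IsBounded (τ ⁻¹' B) := by
    obtain ⟨M, hM⟩ := hBb.exists_norm_le
    refine isBounded_iff_forall_norm_le.2 ⟨M + ‖o‖, fun x hx => ?_⟩
    have h1 : ‖o + x‖ ≤ M := hM _ hx
    have h2 := norm_add_le (o + x) (-o)
    rw [norm_neg, add_neg_cancel_comm] at h2
    linarith
  obtain ⟨h, hh⟩ := exists_homeomorph_image_eq_union_of_mem_nhds_zero (E := τ ⁻¹' E)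
    (hA.translate_preimage_right o) (hAc.preimage hτ) (hnhds hoA)
    ⟨hB.translate_preimage_right o, hnhds hoB, hbdd⟩ (hBc.preimage hτ) hη (fun z hz => by
      refine hE (τ z) ?_
      obtain ⟨y, hy, hyz⟩ := Metric.mem_thickening_iff.1 hz
      exact Metric.mem_thickening_iff.2 ⟨τ y, hy, by simpa [τ] using hyz⟩)
  refine ⟨(τ.symm.trans h).trans τ, ?_⟩
  have : (τ.symm.trans h).trans τ '' E = τ '' (h '' (τ ⁻¹' E)) := by
    rw [← τ.image_symm, image_image, image_image]; rfl
  rw [this, hh]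
  exact image_preimage_eq (E ∪ B) τ.surjective

end RadialPush
/-- `(i, a, b)` is a maximal vertical run of cells `(i, l)`, `a ≤ l < b`, in the complement of
`R`. -/
structure IsRun (R : ℤ → ℤ → Prop) (v : ℤ × ℤ × ℤ) : Prop where
  lt : v.2.1 < v.2.2
  notMem : ∀ l, v.2.1 ≤ l → l < v.2.2 → ¬R v.1 l
  below : R v.1 (v.2.1 - 1)
  above : R v.1 v.2.2

/-- The run `w` is in the column to the right of the run `v` and they share a segment. Here the
cell `(i, l)` occupies the heights from `2 * l + i` to `2 * l + i + 2`. -/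
def RightAdj (v w : ℤ × ℤ × ℤ) : Prop := w.1 = v.1 + 1 ∧ v.2.1 ≤ w.2.2 ∧ w.2.1 < v.2.2

/-- The adjacency graph of the runs. -/
def runGraph (R : ℤ → ℤ → Prop) : SimpleGraph (ℤ × ℤ × ℤ) where
  Adj v w := IsRun R v ∧ IsRun R w ∧ (RightAdj v w ∨ RightAdj w v)
  symm := ⟨fun _ _ h => ⟨h.2.1, h.1, h.2.2.symm⟩⟩
  loopless := ⟨fun v h => by
    rcases h.2.2 with h | h <;> · have := h.1; omega⟩

/-- Any two members of `R` are joined by a chain in `R` of edge-adjacent cells of the sheared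
(hexagonally adjacent) grid, expressed through invariants. -/
def CellConnected (R : ℤ → ℤ → Prop) : Prop :=
  ∀ F : ℤ → ℤ → ZMod 2, (∀ i j, R i j → R i (j + 1) → F i j = F i (j + 1)) →
    (∀ i j j', (j' = j ∨ j' = j - 1) → R i j → R (i + 1) j' → F i j = F (i + 1) j') →
    ∀ i j i' j', R i j → R i' j' → F i j = F i' j'

lemma IsRun.disjoint {R : ℤ → ℤ → Prop} {v w : ℤ × ℤ × ℤ} (hv : IsRun R v) (hw : IsRun R w)
    (h : v.1 = w.1) (hne : v ≠ w) : v.2.2 < w.2.1 ∨ w.2.2 < v.2.1 := by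
  obtain ⟨i, a, b⟩ := v
  obtain ⟨i', c, d⟩ := w
  obtain ⟨h1, h2, h3, h4⟩ := hv
  obtain ⟨k1, k2, k3, k4⟩ := hw
  dsimp only at *
  subst h
  by_contra! hcon
  have e1 : ¬ b < d := fun h => k2 b hcon.1 h h4
  have e2 : ¬ d < b := fun h => h2 d hcon.2 h k4
  have e3 : ¬ a < c := fun h => h2 (c - 1) (by omega) (by omega) k3
  have e4 : ¬ c < a := fun h => k2 (a - 1) (by omega) (by omega) h3
  exact hne (by rw [show a = c by omega, show b = d by omega])

lemma IsRun.lt_or_le {R : ℤ → ℤ → Prop} {v : ℤ × ℤ × ℤ} (hv : IsRun R v) {i j : ℤ} (hi : v.1 = i)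
    (h : R i j) : j < v.2.1 ∨ v.2.2 ≤ j := by
  by_contra! hcon
  exact hv.notMem j hcon.1 hcon.2 (hi ▸ h)

section Parity

open scoped Classical in
/-- The total weight of the pairs in `P` that satisfy `p`. -/
def pairSum (P : Finset (ℤ × ℤ × ℤ)) (ω : ℤ × ℤ × ℤ → ℤ × ℤ × ℤ → ZMod 2)
    (p : ℤ × ℤ × ℤ → ℤ × ℤ × ℤ → Prop) : ZMod 2 :=
  ∑ v ∈ P, ∑ w ∈ P, if p v w then ω v w else 0

variable {P : Finset (ℤ × ℤ × ℤ)} {ω : ℤ × ℤ × ℤ → ℤ × ℤ × ℤ → ZMod 2}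

lemma pairSum_congr {p q : ℤ × ℤ × ℤ → ℤ × ℤ × ℤ → Prop}
    (h : ∀ v ∈ P, ∀ w ∈ P, p v w ↔ q v w) : pairSum P ω p = pairSum P ω q := by
  classical
  exact Finset.sum_congr rfl fun v hv => Finset.sum_congr rfl fun w hw =>
    if_congr (h v hv w hw) rfl rfl

lemma pairSum_swap (hω : ∀ v w, ω v w = ω w v) (p : ℤ × ℤ × ℤ → ℤ × ℤ × ℤ → Prop) :
    pairSum P ω p = pairSum P ω fun v w => p w v := by
  rw [pairSum, Finset.sum_comm]
  simp only [pairSum, hω]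

lemma pairSum_insert {p q : ℤ × ℤ × ℤ → ℤ × ℤ × ℤ → Prop} {v₀ w₀ : ℤ × ℤ × ℤ} (hv₀ : v₀ ∈ P)
    (hw₀ : w₀ ∈ P) (h : ∀ v ∈ P, ∀ w ∈ P, p v w ↔ q v w ∨ (v = v₀ ∧ w = w₀)) (hq : ¬q v₀ w₀) :
    pairSum P ω p = pairSum P ω q + ω v₀ w₀ := by
  classical
  have h1 : ω v₀ w₀ = ∑ v ∈ P, ∑ w ∈ P, if v = v₀ ∧ w = w₀ then ω v w else 0 := by
    rw [Finset.sum_eq_single_of_mem v₀ hv₀ fun v _ hv => Finset.sum_eq_zero fun w _ => by simp [hv],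
      Finset.sum_eq_single_of_mem w₀ hw₀ fun w _ hw => by simp [hw]]
    simp
  rw [h1, pairSum, pairSum, ← Finset.sum_add_distrib]
  refine Finset.sum_congr rfl fun v hv => ?_
  rw [← Finset.sum_add_distrib]
  refine Finset.sum_congr rfl fun w hw => ?_
  simp only [h v hv w hw]
  by_cases h2 : v = v₀ ∧ w = w₀
  · obtain ⟨rfl, rfl⟩ := h2
    simp [hq]
  · simp [h2]

lemma weight_eq_zero_of_cellConnected {R : ℤ → ℤ → Prop} (hR : CellConnected R)
    (hP : ∀ v, v ∈ P ↔ IsRun R v) (hsymm : ∀ v w, ω v w = ω w v)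
    (hadj : ∀ v w, ω v w ≠ 0 → (runGraph R).Adj v w) (hsum : ∀ v ∈ P, ∑ w ∈ P, ω v w = 0)
    {v₀ w₀ : ℤ × ℤ × ℤ} (hv₀ : IsRun R v₀) (hw₀ : IsRun R w₀) (h₀ : RightAdj v₀ w₀) :
    ω v₀ w₀ = 0 := by
  classical
  let F : ℤ → ℤ → ZMod 2 := fun i j =>
    pairSum P ω fun v w => v.1 = i ∧ j < v.2.1 ∧ RightAdj v w
  have hFL : ∀ i j, F i j = pairSum P ω fun v w => w.1 = i ∧ j < w.2.1 ∧ RightAdj v w := by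
    intro i j
    rw [pairSum_swap hsymm]
    have : F i j + (pairSum P ω fun v w => v.1 = i ∧ j < v.2.1 ∧ RightAdj w v) = 0 := by
      simp only [F, pairSum]
      rw [← Finset.sum_add_distrib]
      refine Finset.sum_eq_zero fun v hv => ?_
      rw [← Finset.sum_add_distrib]
      by_cases hvi : v.1 = i ∧ j < v.2.1
      · refine (Finset.sum_congr rfl fun w _ => ?_).trans (hsum v hv)
        by_cases h0 : ω v w = 0
        · simp [h0]
        · rcases (hadj v w h0).2.2 with h | h
          · have : ¬RightAdj w v := fun h' => by have := h.1; have := h'.1; omega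
            simp [hvi, h, this]
          · have : ¬RightAdj v w := fun h' => by have := h.1; have := h'.1; omega
            simp [hvi, h, this]
      · refine Finset.sum_eq_zero fun w _ => ?_
        simp only [← and_assoc, hvi, false_and, if_false, add_zero]
    exact CharTwo.add_eq_zero.1 this
  have hF := hR F (fun i j h1 h2 => pairSum_congr fun v hv w _ => by
      have := ((hP v).1 hv).lt_or_le (j := j + 1) (i := i)
      have := ((hP v).1 hv).lt
      constructor
      · rintro ⟨hi, hj, hr⟩
        exact ⟨hi, by rcases ((hP v).1 hv).lt_or_le hi h2 with h | h <;> omega, hr⟩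
      · rintro ⟨hi, hj, hr⟩
        exact ⟨hi, by omega, hr⟩)
    (fun i j j' hj' h1 h2 => by
      rw [hFL (i + 1) j']
      refine pairSum_congr fun v hv w hw => ?_
      constructor
      · rintro ⟨hi, hj, hr⟩
        refine ⟨by rw [hr.1, hi], ?_, hr⟩
        have := ((hP w).1 hw).lt_or_le (by rw [hr.1, hi]) h2
        have := hr.2
        omega
      · rintro ⟨hi, hj, hr⟩
        have hi' : v.1 = i := by have := hr.1; omega
        refine ⟨hi', ?_, hr⟩
        have := ((hP v).1 hv).lt_or_le hi' h1
        have := hr.2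
        omega)
  have key : ∀ {p q : ℤ × ℤ × ℤ → ℤ × ℤ × ℤ → Prop}, pairSum P ω p = pairSum P ω q →
      (∀ v ∈ P, ∀ w ∈ P, p v w ↔ q v w ∨ (v = v₀ ∧ w = w₀)) → ¬q v₀ w₀ → ω v₀ w₀ = 0 := by
    intro p q h1 h2 h3
    rw [pairSum_insert ((hP _).2 hv₀) ((hP _).2 hw₀) h2 h3] at h1
    simpa using h1
  have hsep : ∀ v ∈ P, ∀ w ∈ P, v.1 = v₀.1 → RightAdj v w →
      (v = v₀ ∧ w = w₀) ∨ (v = v₀ ∧ w ≠ w₀ ∧ (w.2.2 < w₀.2.1 ∨ w₀.2.2 < w.2.1)) ∨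
      (v ≠ v₀ ∧ w = w₀ ∧ (v.2.2 < v₀.2.1 ∨ v₀.2.2 < v.2.1)) ∨
      (v ≠ v₀ ∧ w ≠ w₀ ∧ (w.2.2 < w₀.2.1 ∨ w₀.2.2 < w.2.1) ∧
        (v.2.2 < v₀.2.1 ∨ v₀.2.2 < v.2.1)) := by
    intro v hv w hw hi hr
    have e1 := ((hP v).1 hv).disjoint hv₀ hi
    have e2 := ((hP w).1 hw).disjoint hw₀ (by rw [hr.1, h₀.1, hi])
    tauto
  have hlt := hv₀.lt
  have hlt' := hw₀.lt
  have h₀2 := h₀.2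
  have bottom : ∃ i j, R i j ∧ ∃ p, F i j = pairSum P ω p ∧
      (∀ v w, p v w → v.1 = v₀.1 ∧ RightAdj v w) ∧
      (∀ v ∈ P, ∀ w ∈ P, v.1 = v₀.1 → RightAdj v w →
        (p v w ↔ v₀.2.1 ≤ v.2.1 ∧ w₀.2.1 ≤ w.2.1)) := by
    rcases le_or_gt v₀.2.1 w₀.2.1 with hb | hb
    · refine ⟨_, _, hw₀.below, _, hFL _ _, fun v w h => ⟨?_, h.2.2⟩, fun v hv w hw hi hr => ?_⟩
      · have := h.2.2.1
        have := h₀.1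
        omega
      · have hw1 : w.1 = w₀.1 := by rw [hr.1, h₀.1, hi]
        simp only [hw1, hr, true_and, and_true]
        have := hr.2
        rcases hsep v hv w hw hi hr with ⟨rfl, rfl⟩ | ⟨rfl, hne, h⟩ | ⟨hne, rfl, h⟩ |
          ⟨hne, hne', h, h'⟩ <;> omega
    · refine ⟨_, _, hv₀.below, _, rfl, fun v w h => ⟨h.1, h.2.2⟩, fun v hv w hw hi hr => ?_⟩
      simp only [hi, hr, true_and, and_true]
      have := hr.2
      rcases hsep v hv w hw hi hr with ⟨rfl, rfl⟩ | ⟨rfl, hne, h⟩ | ⟨hne, rfl, h⟩ |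
        ⟨hne, hne', h, h'⟩ <;> omega
  have top : ∃ i j, R i j ∧ ∃ p, F i j = pairSum P ω p ∧
      (∀ v w, p v w → v.1 = v₀.1 ∧ RightAdj v w) ∧
      (∀ v ∈ P, ∀ w ∈ P, v.1 = v₀.1 → RightAdj v w →
        (p v w ↔ v₀.2.2 < v.2.1 ∨ w₀.2.2 < w.2.1)) := by
    rcases le_or_gt v₀.2.2 w₀.2.2 with hb | hb
    · refine ⟨_, _, hv₀.above, _, rfl, fun v w h => ⟨h.1, h.2.2⟩, fun v hv w hw hi hr => ?_⟩
      simp only [hi, hr, true_and, and_true]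
      have := hr.2
      rcases hsep v hv w hw hi hr with ⟨rfl, rfl⟩ | ⟨rfl, hne, h⟩ | ⟨hne, rfl, h⟩ |
        ⟨hne, hne', h, h'⟩ <;> omega
    · refine ⟨_, _, hw₀.above, _, hFL _ _, fun v w h => ⟨?_, h.2.2⟩, fun v hv w hw hi hr => ?_⟩
      · have := h.2.2.1
        have := h₀.1
        omega
      · have hw1 : w.1 = w₀.1 := by rw [hr.1, h₀.1, hi]
        simp only [hw1, hr, true_and, and_true]
        have := hr.2
        rcases hsep v hv w hw hi hr with ⟨rfl, rfl⟩ | ⟨rfl, hne, h⟩ | ⟨hne, rfl, h⟩ |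
          ⟨hne, hne', h, h'⟩ <;> omega
  obtain ⟨i, j, hij, p, hFp, hp, hp'⟩ := bottom
  obtain ⟨i', j', hij', q, hFq, hq, hq'⟩ := top
  refine key (hFp.symm.trans ((hF _ _ _ _ hij hij').trans hFq)) (fun v hv w hw => ?_) ?_
  · by_cases hr : v.1 = v₀.1 ∧ RightAdj v w
    · rw [hp' v hv w hw hr.1 hr.2, hq' v hv w hw hr.1 hr.2]
      have hr2 := hr.2.2
      have := ((hP v).1 hv).lt
      have := ((hP w).1 hw).lt
      rcases hsep v hv w hw hr.1 hr.2 with ⟨rfl, rfl⟩ | ⟨rfl, hne, h⟩ | ⟨hne, rfl, h⟩ |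
        ⟨hne, hne', h, h'⟩
      · simp
      · simp only [hne, and_false, or_false]
        omega
      · simp only [hne, false_and, or_false]
        omega
      · simp only [hne, false_and, or_false]
        omega
    · refine iff_of_false (fun h => hr (hp _ _ h)) ?_
      rintro (h | ⟨rfl, rfl⟩)
      exacts [hr (hq _ _ h), hr ⟨rfl, h₀⟩]
  · rw [hq' _ ((hP _).2 hv₀) _ ((hP _).2 hw₀) rfl h₀]
    omega

end Parity

lemma isAcyclic_runGraph {R : ℤ → ℤ → Prop} (hR : CellConnected R) {P : Finset (ℤ × ℤ × ℤ)}
    (hP : ∀ v, v ∈ P ↔ IsRun R v) : (runGraph R).IsAcyclic := by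
  classical
  intro u c hc
  let ω : ℤ × ℤ × ℤ → ℤ × ℤ × ℤ → ZMod 2 := fun v w => if s(v, w) ∈ c.edges then 1 else 0
  have hsymm : ∀ v w, ω v w = ω w v := fun v w => by simp only [ω, Sym2.eq_swap]
  have hadj : ∀ v w, ω v w ≠ 0 → (runGraph R).Adj v w := fun v w h => by
    have : s(v, w) ∈ c.edges := by by_contra h'; exact h (if_neg h')
    exact c.adj_of_mem_edges this
  have hsum : ∀ v ∈ P, ∑ w ∈ P, ω v w = 0 := by
    intro v _
    have heven := (hc.isTrail.even_countP_edges_iff v).2 fun h => (h rfl).elim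
    have hcard : (P.filter fun w => s(v, w) ∈ c.edges).card
        = c.edges.countP fun e => v ∈ e := by
      rw [List.countP_eq_length_filter, ← List.toFinset_card_of_nodup (hc.edges_nodup.filter _)]
      refine Finset.card_bij (fun w _ => s(v, w)) (fun w hw => ?_) (fun w _ w' _ h => ?_)
        (fun e he => ?_)
      · simpa using (Finset.mem_filter.1 hw).2
      · exact Sym2.congr_right.1 h
      · simp only [List.mem_toFinset, List.mem_filter, decide_eq_true_eq] at he
        obtain ⟨he, w, rfl⟩ := he
        exact ⟨w, Finset.mem_filter.2 ⟨(hP w).2 (c.adj_of_mem_edges he).2.1, he⟩, rfl⟩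
    rw [← hcard] at heven
    simp only [ω, Finset.sum_boole]
    exact (ZMod.natCast_eq_zero_iff_even).2 heven
  have hzero : ∀ v w, RightAdj v w → s(v, w) ∉ c.edges := fun v w hr h => by
    have ha := c.adj_of_mem_edges h
    have := weight_eq_zero_of_cellConnected hR hP hsymm hadj hsum ha.1 ha.2.1 hr
    simp [ω, h] at this
  obtain ⟨e, he⟩ := List.exists_mem_of_ne_nil c.edges (by
    intro h
    exact hc.not_nil (by simpa using congrArg List.length h))
  induction e with
  | h v w =>
    rcases (c.adj_of_mem_edges he).2.2 with h | h
    · exact hzero v w h he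
    · exact hzero w v h (Sym2.eq_swap ▸ he)

/-- A nonempty finite set of vertices of an acyclic graph has a member with at most one neighbour
in the set. -/
lemma exists_mem_subsingleton_adj {V : Type*} {G : SimpleGraph V} (hG : G.IsAcyclic)
    {Q : Finset V} (hQ : Q.Nonempty) :
    ∃ v ∈ Q, ∀ w ∈ Q, ∀ w' ∈ Q, G.Adj v w → G.Adj v w' → w = w' := by
  classical
  obtain ⟨x, hx⟩ := hQ
  let H := G.induce (Q : Set V)
  have hH : H.IsAcyclic := hG.induce _
  let c := H.connectedComponentMk ⟨x, hx⟩
  have hT := hH.isTree_connectedComponent c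
  by_cases hn : Nontrivial c
  · obtain ⟨⟨v, hvc⟩, hv⟩ := hT.exists_vert_degree_one_of_nontrivial
    obtain ⟨u, -, hu⟩ := SimpleGraph.degree_eq_one_iff_existsUnique_adj.1 hv
    have key : ∀ w (hw : w ∈ Q), G.Adj v w → w = u := by
      intro w hw hvw
      have hadj : H.Adj v ⟨w, hw⟩ := hvw
      have hwc : (⟨w, hw⟩ : (Q : Set V)) ∈ c.supp := c.mem_supp_of_adj_mem_supp hvc hadj
      rw [← hu ⟨_, hwc⟩ hadj]
    exact ⟨v, v.2, fun w hw w' hw' h h' => (key w hw h).trans (key w' hw' h').symm⟩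
  · refine ⟨x, hx, fun w hw w' hw' h h' => ?_⟩
    have hadj : H.Adj ⟨x, hx⟩ ⟨w, hw⟩ := h
    exact (hn ⟨⟨⟨x, hx⟩, rfl⟩, ⟨⟨w, hw⟩, c.mem_supp_of_adj_mem_supp rfl hadj⟩, fun h => by
      have h1 : x = w := congrArg (fun z : c.supp => (z.1 : V)) h
      exact hadj.ne (by simp [h1])⟩).elim
/-- The set `E` is a union of finitely many pairwise disjoint compact disks. -/
def IsDiskUnion {X : Type*} [TopologicalSpace X] (E : Set X) : Prop :=
  ∃ (n : ℕ) (D : Fin n → Set X),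
    (∀ i, IsCompact (D i) ∧ Nonempty (↥(D i) ≃ₜ ↥(Metric.closedBall (0 : R2) 1))) ∧
    (Pairwise fun i j => Disjoint (D i) (D j)) ∧ E = ⋃ i, D i

/-- The plane as a product of two lines. -/
def planeEquiv : R2 ≃L[ℝ] ℝ × ℝ :=
  (EuclideanSpace.equiv (Fin 2) ℝ).trans (ContinuousLinearEquiv.finTwoArrow ℝ ℝ)

section IsDiskUnion

variable {X Y : Type*} [TopologicalSpace X] [TopologicalSpace Y]

lemma isDiskUnion_empty : IsDiskUnion (∅ : Set X) :=
  ⟨0, Fin.elim0, fun i => i.elim0, fun i => i.elim0, by simp⟩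

lemma IsDiskUnion.image {E : Set X} (hE : IsDiskUnion E) (h : X ≃ₜ Y) : IsDiskUnion (h '' E) := by
  obtain ⟨n, D, hD, hdisj, rfl⟩ := hE
  refine ⟨n, fun i => h '' D i, fun i => ⟨(hD i).1.image h.continuous, ?_⟩, fun i j hij => ?_,
    image_iUnion⟩
  · obtain ⟨e⟩ := (hD i).2
    exact ⟨(h.image (D i)).symm.trans e⟩
  · exact (disjoint_image_iff h.injective).2 (hdisj hij)

lemma IsDiskUnion.union {E B : Set X} (hE : IsDiskUnion E) (hB : IsCompact B)
    (hB' : Nonempty (B ≃ₜ Metric.closedBall (0 : R2) 1)) (hEB : Disjoint E B) :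
    IsDiskUnion (E ∪ B) := by
  obtain ⟨n, D, hD, hdisj, rfl⟩ := hE
  rw [disjoint_iUnion_left] at hEB
  refine ⟨n + 1, Fin.cons B D, Fin.cases ⟨hB, hB'⟩ hD, fun i j => ?_, ?_⟩
  · refine Fin.cases (Fin.cases (fun h => (h rfl).elim) (fun j _ => (hEB j).symm) j)
      (fun i => Fin.cases (fun _ => hEB i)
        (fun j h => hdisj fun hij => h (congrArg Fin.succ hij)) j) i
  · ext x
    simp only [mem_union, mem_iUnion, Fin.exists_fin_succ, Fin.cons_zero, Fin.cons_succ]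
    exact or_comm

end IsDiskUnion

lemma nonempty_homeomorph_closedBall_of_convex {B : Set (ℝ × ℝ)} (hB : Convex ℝ B)
    (hBc : IsCompact B) (hne : (interior B).Nonempty) :
    Nonempty (B ≃ₜ Metric.closedBall (0 : R2) 1) := by
  let e := planeEquiv.toHomeomorph.symm
  have hcvx : Convex ℝ (e '' B) := hB.linear_image planeEquiv.symm.toLinearEquiv.toLinearMap
  have hcpt : IsCompact (e '' B) := hBc.image e.continuous
  obtain ⟨h, -, hcl, -⟩ := exists_homeomorph_image_interior_closure_frontier_eq_unitBall hcvx
    (by rw [← e.image_interior]; exact hne.image _) hcpt.isBounded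
  rw [hcpt.isClosed.closure_eq] at hcl
  exact ⟨((e.image B).trans (h.image _)).trans (Homeomorph.setCongr hcl)⟩

/-- The rectangle spanned by a run of cells, widened horizontally. -/
def piece (v : ℤ × ℤ × ℤ) : Set (ℝ × ℝ) :=
  Icc ((v.1 : ℝ) - 1 / 8) (v.1 + 1 + 1 / 8) ×ˢ Icc (2 * v.2.1 + v.1 : ℝ) (2 * v.2.2 + v.1)

lemma convex_piece (v : ℤ × ℤ × ℤ) : Convex ℝ (piece v) := (convex_Icc _ _).prod (convex_Icc _ _)

lemma isCompact_piece (v : ℤ × ℤ × ℤ) : IsCompact (piece v) := isCompact_Icc.prod isCompact_Icc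

lemma interior_piece (v : ℤ × ℤ × ℤ) : interior (piece v) =
    Ioo ((v.1 : ℝ) - 1 / 8) (v.1 + 1 + 1 / 8) ×ˢ Ioo (2 * v.2.1 + v.1 : ℝ) (2 * v.2.2 + v.1) := by
  rw [piece, interior_prod_eq, interior_Icc, interior_Icc]

lemma interior_piece_inter_nonempty {v w : ℤ × ℤ × ℤ} (hv : v.2.1 < v.2.2) (hw : w.2.1 < w.2.2)
    (h : RightAdj v w) : (interior (piece v) ∩ interior (piece w)).Nonempty := by
  obtain ⟨h1, h2, h3⟩ := h
  rw [interior_piece, interior_piece, prod_inter_prod, Ioo_inter_Ioo, Ioo_inter_Ioo]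
  have e1 : (w.1 : ℝ) = v.1 + 1 := by exact_mod_cast h1
  have e2 : (v.2.1 : ℝ) ≤ w.2.2 := by exact_mod_cast h2
  have e3 : (w.2.1 : ℝ) + 1 ≤ v.2.2 := by exact_mod_cast h3
  have e4 : (v.2.1 : ℝ) + 1 ≤ v.2.2 := by exact_mod_cast hv
  have e5 : (w.2.1 : ℝ) + 1 ≤ w.2.2 := by exact_mod_cast hw
  refine Set.Nonempty.prod (nonempty_Ioo.2 ?_) (nonempty_Ioo.2 ?_)
  · refine max_lt (lt_min ?_ ?_) (lt_min ?_ ?_) <;> linarith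
  · refine max_lt (lt_min ?_ ?_) (lt_min ?_ ?_) <;> linarith

lemma disjoint_thickening_piece {R : ℤ → ℤ → Prop} {v w : ℤ × ℤ × ℤ} (hv : IsRun R v)
    (hw : IsRun R w) (hne : v ≠ w) (hadj : ¬(runGraph R).Adj v w) :
    Disjoint (Metric.thickening (1 / 2) (piece v)) (piece w) := by
  refine Set.disjoint_left.2 fun z hz hzw => hadj ⟨hv, hw, ?_⟩
  obtain ⟨y, hy, hzy⟩ := Metric.mem_thickening_iff.1 hz
  rw [Prod.dist_eq, max_lt_iff, Real.dist_eq, Real.dist_eq, abs_lt, abs_lt] at hzy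
  obtain ⟨⟨a1, a2⟩, b1, b2⟩ := hzy
  obtain ⟨⟨c1, c2⟩, c3, c4⟩ := hy
  obtain ⟨⟨d1, d2⟩, d3, d4⟩ := hzw
  have x1 : v.1 < w.1 + 2 := by
    have : (v.1 : ℝ) < w.1 + 2 := by linarith
    exact_mod_cast this
  have x2 : w.1 < v.1 + 2 := by
    have : (w.1 : ℝ) < v.1 + 2 := by linarith
    exact_mod_cast this
  have y1 : 2 * v.2.1 + v.1 < 2 * w.2.2 + w.1 + 1 := by
    have : (2 * v.2.1 + v.1 : ℝ) < 2 * w.2.2 + w.1 + 1 := by linarith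
    exact_mod_cast this
  have y2 : 2 * w.2.1 + w.1 < 2 * v.2.2 + v.1 + 1 := by
    have : (2 * w.2.1 + w.1 : ℝ) < 2 * v.2.2 + v.1 + 1 := by linarith
    exact_mod_cast this
  rcases lt_trichotomy v.1 w.1 with h | h | h
  · left
    refine ⟨?_, ?_, ?_⟩ <;> omega
  · have := hv.disjoint hw h hne
    omega
  · right
    refine ⟨?_, ?_, ?_⟩ <;> omega

lemma isDiskUnion_iUnion_piece {R : ℤ → ℤ → Prop} (hG : (runGraph R).IsAcyclic)
    (Q : Finset (ℤ × ℤ × ℤ)) (hQ : ∀ v ∈ Q, IsRun R v) : IsDiskUnion (⋃ v ∈ Q, piece v) := by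
  induction hn : Q.card generalizing Q with
  | zero =>
    rw [Finset.card_eq_zero.1 hn]
    simpa using isDiskUnion_empty
  | succ n ih =>
    obtain ⟨v, hv, hsub⟩ := exists_mem_subsingleton_adj hG
      (Finset.card_pos.1 (by rw [hn]; exact n.succ_pos))
    have ih' := ih (Q.erase v) (fun w hw => hQ w (Finset.mem_of_mem_erase hw))
      (by rw [Finset.card_erase_of_mem hv, hn, Nat.add_sub_cancel])
    have hunion : ⋃ w ∈ Q, piece w = (⋃ w ∈ Q.erase v, piece w) ∪ piece v := by
      rw [← Finset.insert_erase hv, Finset.set_biUnion_insert, Finset.erase_insert (by simp),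
        union_comm]
    have hsep : ∀ w ∈ Q.erase v, ¬(runGraph R).Adj v w →
        Disjoint (Metric.thickening (1 / 2) (piece v)) (piece w) := fun w hw h =>
      disjoint_thickening_piece (hQ v hv) (hQ w (Finset.mem_of_mem_erase hw))
        (Finset.ne_of_mem_erase hw).symm h
    rw [hunion]
    by_cases hex : ∃ w ∈ Q.erase v, (runGraph R).Adj v w
    · obtain ⟨w, hw, hvw⟩ := hex
      have hwQ := Finset.mem_of_mem_erase hw
      have hmeet : (interior (piece w) ∩ interior (piece v)).Nonempty := by
        rcases hvw.2.2 with h | h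
        · rw [inter_comm]
          exact interior_piece_inter_nonempty (hQ v hv).lt (hQ w hwQ).lt h
        · exact interior_piece_inter_nonempty (hQ w hwQ).lt (hQ v hv).lt h
      obtain ⟨h, hh⟩ := exists_homeomorph_image_eq_union (E := ⋃ w ∈ Q.erase v, piece w)
        (convex_piece w) (isCompact_piece w).isClosed (convex_piece v) (isCompact_piece v).isClosed
        (isCompact_piece v).isBounded hmeet (η := 1 / 2) (by norm_num) (fun z hz => by
          refine ⟨fun hzE => ?_, fun hzw => mem_biUnion hw hzw⟩
          obtain ⟨u, hu, hzu⟩ := mem_iUnion₂.1 hzE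
          have hvu : (runGraph R).Adj v u := by
            by_contra hcon
            exact Set.disjoint_left.1 (hsep u hu hcon) hz hzu
          rwa [hsub w hwQ u (Finset.mem_of_mem_erase hu) hvw hvu])
      rw [← hh]
      exact ih'.image h
    · push Not at hex
      refine ih'.union (isCompact_piece v) (nonempty_homeomorph_closedBall_of_convex
        (convex_piece v) (isCompact_piece v) ?_) ?_
      · have : (v.2.1 : ℝ) < v.2.2 := by exact_mod_cast (hQ v hv).lt
        rw [interior_piece]
        exact Set.Nonempty.prod (nonempty_Ioo.2 (by linarith)) (nonempty_Ioo.2 (by linarith))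
      · simp only [disjoint_iUnion_left]
        exact fun w hw => ((hsep w hw (hex w hw)).mono_left
          (Metric.self_subset_thickening (by norm_num) _)).symm

/-- A cell of the sheared grid. -/
def cell (i j : ℤ) : Set (ℝ × ℝ) := Icc (i : ℝ) (i + 1) ×ˢ Icc (2 * j + i : ℝ) (2 * j + i + 2)

lemma mem_cell {i j : ℤ} {z : ℝ × ℝ} : z ∈ cell i j ↔
    ((i : ℝ) ≤ z.1 ∧ z.1 ≤ i + 1) ∧ (2 * j + i : ℝ) ≤ z.2 ∧ z.2 ≤ 2 * j + i + 2 := Iff.rfl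

lemma exists_mem_cell (z : ℝ × ℝ) : ∃ i j, z ∈ cell i j := by
  refine ⟨⌊z.1⌋, ⌊(z.2 - ⌊z.1⌋) / 2⌋, ?_⟩
  rw [mem_cell]
  have h1 := Int.floor_le z.1
  have h2 := Int.lt_floor_add_one z.1
  have h3 := Int.floor_le ((z.2 - ⌊z.1⌋) / 2)
  have h4 := Int.lt_floor_add_one ((z.2 - ⌊z.1⌋) / 2)
  refine ⟨⟨?_, ?_⟩, ?_, ?_⟩ <;> linarith

lemma locallyFinite_cell : LocallyFinite fun p : ℤ × ℤ => cell p.1 p.2 := by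
  intro z
  refine ⟨Metric.ball z 1, Metric.ball_mem_nhds z one_pos, ?_⟩
  obtain ⟨i, j, hz⟩ := exists_mem_cell z
  refine ((Set.finite_Icc (i - 2) (i + 2)).prod (Set.finite_Icc (j - 4) (j + 4))).subset ?_
  rintro ⟨k, l⟩ ⟨y, hy, hyz⟩
  rw [Metric.mem_ball, Prod.dist_eq, max_lt_iff, Real.dist_eq, Real.dist_eq, abs_lt, abs_lt] at hyz
  rw [mem_cell] at hz hy
  obtain ⟨⟨a1, a2⟩, a3, a4⟩ := hyz
  obtain ⟨⟨b1, b2⟩, b3, b4⟩ := hz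
  obtain ⟨⟨c1, c2⟩, c3, c4⟩ := hy
  dsimp only at *
  have x1 : i < k + 2 := by
    have : (i : ℝ) < k + 2 := by linarith
    exact_mod_cast this
  have x2 : k < i + 2 := by
    have : (k : ℝ) < i + 2 := by linarith
    exact_mod_cast this
  have y1 : 2 * j + i < 2 * l + k + 3 := by
    have : (2 * j + i : ℝ) < 2 * l + k + 3 := by linarith
    exact_mod_cast this
  have y2 : 2 * l + k < 2 * j + i + 3 := by
    have : (2 * l + k : ℝ) < 2 * j + i + 3 := by linarith
    exact_mod_cast this
  simp only [mem_prod, mem_Icc]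
  omega

lemma isClosed_iUnion_cell (S : Set (ℤ × ℤ)) : IsClosed (⋃ p : S, cell p.1.1 p.1.2) :=
  (locallyFinite_cell.comp_injective Subtype.val_injective).isClosed_iUnion
    fun _ => isClosed_Icc.prod isClosed_Icc

lemma cellConnected_of_isPreconnected {C : Set (ℝ × ℝ)} (hC : IsPreconnected C) :
    CellConnected fun i j => (cell i j ∩ C).Nonempty := by
  intro F hvert hhor
  have key : ∀ i j i' j' z, i ≤ i' → z ∈ C → z ∈ cell i j → z ∈ cell i' j' →
      F i j = F i' j' := by
    intro i j i' j' z hi hz h h'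
    have hR : (cell i j ∩ C).Nonempty := ⟨z, h, hz⟩
    have hR' : (cell i' j' ∩ C).Nonempty := ⟨z, h', hz⟩
    rw [mem_cell] at h h'
    obtain ⟨⟨b1, b2⟩, b3, b4⟩ := h
    obtain ⟨⟨c1, c2⟩, c3, c4⟩ := h'
    have x2 : i' ≤ i + 1 := by
      have : (i' : ℝ) ≤ i + 1 := by linarith
      exact_mod_cast this
    have y1 : 2 * j + i ≤ 2 * j' + i' + 2 := by
      have : (2 * j + i : ℝ) ≤ 2 * j' + i' + 2 := by linarith
      exact_mod_cast this
    have y2 : 2 * j' + i' ≤ 2 * j + i + 2 := by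
      have : (2 * j' + i' : ℝ) ≤ 2 * j + i + 2 := by linarith
      exact_mod_cast this
    obtain rfl | rfl : i' = i ∨ i' = i + 1 := by omega
    · obtain rfl | rfl | rfl : j' = j ∨ j' = j + 1 ∨ j = j' + 1 := by omega
      · rfl
      · exact hvert _ _ hR hR'
      · exact (hvert _ _ hR' hR).symm
    · exact hhor _ _ _ (by omega) hR hR'
  have key' : ∀ i j i' j' z, z ∈ C → z ∈ cell i j → z ∈ cell i' j' → F i j = F i' j' := by
    intro i j i' j' z hz h h'
    rcases le_total i i' with hi | hi
    · exact key _ _ _ _ z hi hz h h'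
    · exact (key _ _ _ _ z hi hz h' h).symm
  rintro i j i' j' ⟨x, hx, hxC⟩ ⟨y, hy, hyC⟩
  by_contra hne
  obtain ⟨z, hz, hz1, hz2⟩ := isPreconnected_closed_iff.1 hC _ _
    (isClosed_iUnion_cell {p | F p.1 p.2 = F i j}) (isClosed_iUnion_cell {p | F p.1 p.2 ≠ F i j})
    (fun z _ => by
      obtain ⟨k, l, hkl⟩ := exists_mem_cell z
      by_cases h : F k l = F i j
      · exact Or.inl (mem_iUnion.2 ⟨⟨(k, l), h⟩, hkl⟩)
      · exact Or.inr (mem_iUnion.2 ⟨⟨(k, l), h⟩, hkl⟩))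
    ⟨x, hxC, mem_iUnion.2 ⟨⟨(i, j), rfl⟩, hx⟩⟩
    ⟨y, hyC, mem_iUnion.2 ⟨⟨(i', j'), fun h => hne h.symm⟩, hy⟩⟩
  obtain ⟨⟨p, hp⟩, hzp⟩ := mem_iUnion.1 hz1
  obtain ⟨⟨q, hq⟩, hzq⟩ := mem_iUnion.1 hz2
  exact hq ((key' _ _ _ _ z hz hzq hzp).trans hp)

lemma exists_isRun {R : ℤ → ℤ → Prop} {i j : ℤ} (hj : ¬R i j) (hlo : ∃ a ≤ j, R i a)
    (hhi : ∃ b, j ≤ b ∧ R i b) : ∃ a b, IsRun R (i, a, b) ∧ a ≤ j ∧ j < b := by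
  classical
  obtain ⟨a₀, ha₀⟩ := hlo
  obtain ⟨b₀, hb₀⟩ := hhi
  obtain ⟨a, ⟨haj, ha⟩, hamax⟩ := Int.exists_greatest_of_bdd (P := fun a => a ≤ j ∧ R i a)
    ⟨j, fun _ h => h.1⟩ ⟨a₀, ha₀⟩
  obtain ⟨b, ⟨hbj, hb⟩, hbmin⟩ := Int.exists_least_of_bdd (P := fun b => j ≤ b ∧ R i b)
    ⟨j, fun _ h => h.1⟩ ⟨b₀, hb₀⟩
  have haj' : a ≠ j := fun h => hj (h ▸ ha)
  have hbj' : b ≠ j := fun h => hj (h ▸ hb)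
  refine ⟨a + 1, b, ⟨show a + 1 < b by omega, fun l h1 h2 h3 => ?_, by simpa using ha, hb⟩,
    by omega, by omega⟩
  dsimp only at h1 h2 h3
  rcases le_total l j with hl | hl
  · have := hamax l ⟨hl, h3⟩
    omega
  · have := hbmin l ⟨hl, h3⟩
    omega

/-- If `C` is connected and has bounded complement, a finite disjoint union of disks contains all
points far from `C` in its interior and is contained in the `1`-neighbourhood of `Cᶜ`. -/
lemma exists_isDiskUnion_of_isPreconnected {C : Set (ℝ × ℝ)} (hC : IsPreconnected C)
    (hb : IsBounded Cᶜ) : ∃ E, IsDiskUnion E ∧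
      (∀ p, Disjoint (Metric.ball p 4) C → p ∈ interior E) ∧ E ⊆ Metric.thickening 1 Cᶜ := by
  classical
  let R : ℤ → ℤ → Prop := fun i j => (cell i j ∩ C).Nonempty
  have hR : ∀ i j, ¬R i j → ∀ z ∈ cell i j, z ∈ Cᶜ := fun i j h z hz hzC => h ⟨z, hz, hzC⟩
  obtain ⟨M, hM⟩ : ∃ M : ℤ, ∀ i j, ¬R i j → -M < i ∧ i < M ∧ -M < j ∧ j < M := by
    obtain ⟨r, hr⟩ := hb.subset_closedBall 0
    refine ⟨⌊r⌋ + 1, fun i j h => ?_⟩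
    have := hr (hR i j h ((i : ℝ), (2 * j + i : ℝ)) (by
      rw [mem_cell]; refine ⟨⟨?_, ?_⟩, ?_, ?_⟩ <;> linarith))
    rw [mem_closedBall_zero_iff, Prod.norm_def, max_le_iff, Real.norm_eq_abs, Real.norm_eq_abs,
      abs_le, abs_le] at this
    obtain ⟨⟨a1, a2⟩, a3, a4⟩ := this
    dsimp only at a1 a2 a3 a4
    have b1 : i ≤ ⌊r⌋ := Int.le_floor.2 a2
    have b2 : -i ≤ ⌊r⌋ := Int.le_floor.2 (by push_cast; linarith)
    have b3 : 2 * j + i ≤ ⌊r⌋ := Int.le_floor.2 (by push_cast; linarith)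
    have b4 : -(2 * j + i) ≤ ⌊r⌋ := Int.le_floor.2 (by push_cast; linarith)
    omega
  have hfin : {v | IsRun R v}.Finite := by
    refine ((Set.finite_Icc (-M) M).prod ((Set.finite_Icc (-M) M).prod
      (Set.finite_Icc (-M) M))).subset ?_
    rintro ⟨i, a, b⟩ hv
    have hlt := hv.lt
    have h1 := hM _ _ (hv.notMem a le_rfl hlt)
    have h2 := hM _ _ (hv.notMem (b - 1) (by dsimp only at *; omega) (by dsimp only; omega))
    simp only [mem_prod, mem_Icc] at *
    omega
  have hP : ∀ v, v ∈ hfin.toFinset ↔ IsRun R v := fun v => hfin.mem_toFinset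
  have hcover : ∀ i j, ¬R i j → cell i j ⊆ ⋃ v ∈ hfin.toFinset, piece v := by
    intro i j hij z hz
    have hfar : ∀ l, (l ≤ -M ∨ M ≤ l) → R i l := fun l hl => by
      by_contra h
      have := hM i l h
      omega
    have hj := hM i j hij
    obtain ⟨a, b, hv, haj, hjb⟩ := exists_isRun hij ⟨-M, by omega, hfar _ (Or.inl le_rfl)⟩
      ⟨M, by omega, hfar _ (Or.inr le_rfl)⟩
    refine mem_biUnion ((hP _).2 hv) ?_
    rw [mem_cell] at hz
    have e1 : (a : ℝ) ≤ j := by exact_mod_cast haj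
    have e2 : (j : ℝ) + 1 ≤ b := by exact_mod_cast hjb
    refine ⟨⟨?_, ?_⟩, ?_, ?_⟩ <;> dsimp only <;> linarith [hz.1.1, hz.1.2, hz.2.1, hz.2.2]
  refine ⟨⋃ v ∈ hfin.toFinset, piece v, isDiskUnion_iUnion_piece (isAcyclic_runGraph
    (cellConnected_of_isPreconnected hC) hP) _ fun v hv => (hP v).1 hv, fun p hp => ?_, ?_⟩
  · refine mem_interior.2 ⟨Metric.ball p 1, fun z hz => ?_, Metric.isOpen_ball,
      Metric.mem_ball_self one_pos⟩
    obtain ⟨i, j, hij⟩ := exists_mem_cell z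
    refine hcover i j ?_ hij
    rintro ⟨y, hy, hyC⟩
    refine Set.disjoint_left.1 hp ?_ hyC
    rw [mem_cell] at hy hij
    rw [Metric.mem_ball] at hz ⊢
    have hyz : dist y z ≤ 2 := by
      rw [Prod.dist_eq, max_le_iff, Real.dist_eq, Real.dist_eq, abs_le, abs_le]
      refine ⟨⟨?_, ?_⟩, ?_, ?_⟩ <;>
        linarith [hy.1.1, hy.1.2, hy.2.1, hy.2.2, hij.1.1, hij.1.2, hij.2.1, hij.2.2]
    linarith [dist_triangle y z p]
  · refine iUnion₂_subset fun v hv z hz => ?_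
    have hv' := (hP v).1 hv
    obtain ⟨i, a, b⟩ := v
    obtain ⟨⟨z1, z2⟩, z3, z4⟩ := hz
    dsimp only at z1 z2 z3 z4
    have hab : a < b := hv'.lt
    obtain ⟨l, hl1, hl2, hl3, hl4⟩ : ∃ l : ℤ, a ≤ l ∧ l < b ∧ (2 * l + i : ℝ) ≤ z.2 ∧
        z.2 ≤ 2 * l + i + 2 := by
      have h3 := Int.floor_le ((z.2 - i) / 2)
      have h4 := Int.lt_floor_add_one ((z.2 - i) / 2)
      have ha : a ≤ ⌊(z.2 - i) / 2⌋ := Int.le_floor.2 (by linarith)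
      rcases lt_or_ge ⌊(z.2 - i) / 2⌋ b with h | h
      · exact ⟨_, ha, h, by linarith, by linarith⟩
      · have h' : (b : ℝ) ≤ ⌊(z.2 - i) / 2⌋ := by exact_mod_cast h
        refine ⟨b - 1, by omega, by omega, ?_, ?_⟩ <;> push_cast <;> linarith
    refine Metric.mem_thickening_iff.2 ⟨(max i (min (i + 1) z.1), z.2),
      hR i l (hv'.notMem l hl1 hl2) _ ?_, ?_⟩
    · exact ⟨⟨le_max_left _ _, max_le (by linarith) (min_le_left _ _)⟩, hl3, hl4⟩
    · rw [Prod.dist_eq, dist_self, max_lt_iff, Real.dist_eq, abs_lt]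
      refine ⟨⟨?_, ?_⟩, one_pos⟩
      · have : max (i : ℝ) (min (i + 1) z.1) ≤ max (i : ℝ) z.1 :=
          max_le_max le_rfl (min_le_right _ _)
        rcases max_cases (i : ℝ) z.1 with h | h <;> dsimp only at * <;> linarith
      · have h1 := le_max_right (i : ℝ) (min (i + 1) z.1)
        rcases min_cases ((i : ℝ) + 1) z.1 with h | h <;> dsimp only at * <;> linarith

lemma exists_isDiskUnion_of_isPreconnected_of_pos {C : Set (ℝ × ℝ)} (hC : IsPreconnected C)
    (hb : IsBounded Cᶜ) {ε : ℝ} (hε : 0 < ε) : ∃ E, IsDiskUnion E ∧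
      (∀ p, Disjoint (Metric.ball p (4 * ε)) C → p ∈ interior E) ∧
      E ⊆ Metric.thickening ε Cᶜ := by
  let h : ℝ × ℝ ≃ₜ ℝ × ℝ := Homeomorph.smulOfNeZero ε hε.ne'
  have hdist : ∀ x y, dist (h x) (h y) = ε * dist x y := fun x y => by
    change dist (ε • x) (ε • y) = _
    rw [dist_smul₀, Real.norm_of_nonneg hε.le]
  have hdist' : ∀ x y, dist (h.symm x) (h.symm y) = ε⁻¹ * dist x y := fun x y => by
    rw [← h.apply_symm_apply x, ← h.apply_symm_apply y, hdist]
    simp [hε.ne']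
  obtain ⟨E, hE, hint, hsub⟩ := exists_isDiskUnion_of_isPreconnected (C := h.symm '' C)
    (hC.image _ h.symm.continuous.continuousOn) (by
      rw [← image_compl_eq h.symm.bijective]
      exact (LipschitzWith.of_dist_le_mul (K := ⟨ε⁻¹, by positivity⟩)
        fun x y => (hdist' x y).le).isBounded_image hb)
  refine ⟨h '' E, hE.image h, fun p hp => ?_, ?_⟩
  · rw [← h.image_interior]
    refine ⟨h.symm p, hint _ ?_, h.apply_symm_apply p⟩
    refine Set.disjoint_left.2 ?_
    rintro _ hy ⟨x, hx, rfl⟩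
    refine Set.disjoint_left.1 hp ?_ hx
    rw [Metric.mem_ball, hdist', inv_mul_lt_iff₀ hε] at hy
    rw [Metric.mem_ball]
    linarith
  · rintro _ ⟨z, hz, rfl⟩
    obtain ⟨y, hy, hzy⟩ := Metric.mem_thickening_iff.1 (hsub hz)
    refine Metric.mem_thickening_iff.2 ⟨h y, fun hyC => hy ⟨_, hyC, h.symm_apply_apply y⟩, ?_⟩
    rw [hdist]
    nlinarith

section Normed

variable {X : Type*} [NormedAddCommGroup X] [NormedSpace ℝ X]

lemma isPreconnected_setOf_le_norm (hX : 1 < Module.rank ℝ X) {ρ : ℝ} (hρ : 0 < ρ) :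
    IsPreconnected {x : X | ρ ≤ ‖x‖} := by
  have : {x : X | ρ ≤ ‖x‖} = (fun p : X × ℝ => p.2 • p.1) '' (Metric.sphere 0 1 ×ˢ Ici ρ) := by
    ext x
    constructor
    · intro hx
      have hx0 : ‖x‖ ≠ 0 := (hρ.trans_le hx).ne'
      refine ⟨(‖x‖⁻¹ • x, ‖x‖), ⟨?_, hx⟩, ?_⟩
      · simp [norm_smul, hx0]
      · simp [smul_smul, hx0]
    · rintro ⟨⟨u, t⟩, ⟨hu, ht⟩, rfl⟩
      rw [mem_sphere_zero_iff_norm] at hu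
      simpa [norm_smul, hu] using le_trans ht (le_abs_self t)
  rw [this]
  exact ((isPreconnected_sphere hX 0 1).prod isPreconnected_Ici).image _
    (continuous_snd.smul continuous_fst).continuousOn

/-- A compact part of the connected complement of a compact set `L` lies in one component of the
set of points whose distance to `L` exceeds some positive number. -/
lemma exists_subset_connectedComponentIn {L W : Set X} (hL : IsCompact L) (hne : L.Nonempty)
    (hconn : IsConnected Lᶜ) (hW : IsCompact W) (hLW : Disjoint L W) {x₀ : X} (hx₀ : x₀ ∉ L) :
    ∃ n : ℕ, W ⊆ connectedComponentIn {x | 1 / ((n : ℝ) + 1) < Metric.infDist x L} x₀ := by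
  let U : ℕ → Set X := fun n => {x | 1 / ((n : ℝ) + 1) < Metric.infDist x L}
  have hUo : ∀ n, IsOpen (U n) := fun n =>
    isOpen_lt continuous_const (Metric.continuous_infDist_pt L)
  have hU : Monotone U := fun m n hmn x hx => (one_div_le_one_div_of_le (by positivity) (by
    gcongr)).trans_lt (show 1 / ((m : ℝ) + 1) < Metric.infDist x L from hx)
  have hUL : ∀ x, x ∉ L → ∃ n, x ∈ U n := fun x hx =>
    exists_nat_one_div_lt ((hL.isClosed.notMem_iff_infDist_pos hne).1 hx)
  refine hW.elim_directed_cover (fun n => connectedComponentIn (U n) x₀)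
    (fun n => (hUo n).connectedComponentIn) (fun x hx => ?_)
    (directed_of_isDirected_le fun m n hmn => connectedComponentIn_mono x₀ (hU hmn))
  have hpath : IsPathConnected Lᶜ :=
    hL.isClosed.isOpen_compl.isConnected_iff_isPathConnected.1 hconn
  obtain ⟨γ, hγ⟩ := hpath.joinedIn x₀ hx₀ x fun h => Set.disjoint_left.1 hLW h hx
  obtain ⟨n, hn⟩ := (isCompact_range γ.continuous).elim_directed_cover U hUo
    (by
      rintro _ ⟨t, rfl⟩
      exact mem_iUnion.2 (hUL _ (hγ t)))
    (directed_of_isDirected_le fun m n hmn => hU hmn)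
  exact mem_iUnion.2 ⟨n, (isPreconnected_range γ.continuous).subset_connectedComponentIn
    ⟨0, γ.source⟩ hn ⟨1, γ.target⟩⟩

end Normed

lemma exists_isDiskUnion_of_isCompact {L V : Set (ℝ × ℝ)} (hL : IsCompact L)
    (hconn : IsConnected Lᶜ) (hV : IsOpen V) (hLV : L ⊆ V) :
    ∃ E, L ⊆ interior E ∧ E ⊆ V ∧ IsDiskUnion E := by
  rcases L.eq_empty_or_nonempty with rfl | hne
  · exact ⟨∅, empty_subset _, empty_subset _, isDiskUnion_empty⟩
  obtain ⟨r, hr, hrV⟩ := hL.exists_thickening_subset_open hV hLV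
  obtain ⟨ρ, hρ, hLρ⟩ := hL.isBounded.exists_pos_norm_le
  have hrank : 1 < Module.rank ℝ (ℝ × ℝ) := by
    rw [rank_prod', Module.rank_self]
    norm_num
  have hT : ∀ x ∈ {x : ℝ × ℝ | ρ + 2 ≤ ‖x‖}, 1 < Metric.infDist x L := fun x hx => by
    refine one_lt_two.trans_le ((Metric.le_infDist hne).2 fun y hy => ?_)
    have h1 := hLρ y hy
    have h2 := norm_sub_norm_le x y
    rw [dist_eq_norm]
    have h3 : ρ + 2 ≤ ‖x‖ := hx
    linarith
  obtain ⟨x₀, hx₀⟩ : ∃ x₀ : ℝ × ℝ, ρ + 2 ≤ ‖x₀‖ :=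
    ⟨(ρ + 2, 0), (le_abs_self _).trans (norm_fst_le ((ρ + 2, 0) : ℝ × ℝ))⟩
  have hx₀L : x₀ ∉ L := fun h => by linarith [hLρ _ h]
  have hWd : Disjoint L (Metric.closedBall 0 (ρ + 2) \ Metric.thickening (r / 2) L) :=
    disjoint_sdiff_right.mono_left (Metric.self_subset_thickening (by positivity) L)
  obtain ⟨n, hn⟩ := exists_subset_connectedComponentIn hL hne hconn
    ((isCompact_closedBall 0 _).diff Metric.isOpen_thickening) hWd hx₀L
  set δ : ℝ := 1 / ((n : ℝ) + 1) with hδ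
  have hδ0 : 0 < δ := by positivity
  have hδ1 : δ ≤ 1 := (div_le_one (by positivity)).2 (by linarith [n.cast_nonneg (α := ℝ)])
  set C := connectedComponentIn {x | δ < Metric.infDist x L} x₀
  have hTC : {x : ℝ × ℝ | ρ + 2 ≤ ‖x‖} ⊆ C :=
    (isPreconnected_setOf_le_norm hrank (by positivity)).subset_connectedComponentIn hx₀
      fun x hx => hδ1.trans_lt (hT x hx)
  have hCV : Cᶜ ⊆ Metric.thickening (r / 2) L := fun x hx => by
    by_contra hx'
    rcases le_total (ρ + 2) ‖x‖ with h | h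
    · exact hx (hTC h)
    · exact hx (hn ⟨mem_closedBall_zero_iff.2 h, hx'⟩)
  obtain ⟨E, hE, hint, hsub⟩ := exists_isDiskUnion_of_isPreconnected_of_pos
    (C := C) isPreconnected_connectedComponentIn (hL.isBounded.thickening.subset hCV)
    (ε := min (δ / 4) (r / 2)) (by positivity)
  refine ⟨E, fun p hp => hint p (Set.disjoint_left.2 fun z hz hzC => ?_), hsub.trans ?_, hE⟩
  · have h1 : δ < Metric.infDist z L :=
      (connectedComponentIn_subset _ _ hzC : z ∈ {x | δ < Metric.infDist x L})
    have h2 := Metric.infDist_le_dist_of_mem (x := z) hp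
    have h3 := min_le_left (δ / 4) (r / 2)
    rw [Metric.mem_ball] at hz
    linarith
  · refine ((Metric.thickening_subset_of_subset _ hCV).trans
      (Metric.thickening_thickening_subset _ _ _)).trans ((Metric.thickening_mono ?_ L).trans hrV)
    linarith [min_le_right (δ / 4) (r / 2)]

/-- A compact set `L ⊆ ℝ²` with connected complement has arbitrarily small neighbourhoods
that are finite unions of pairwise disjoint compact disks (sets homeomorphic to the closed
unit disk of `ℝ²`). -/
theorem nonseparating_compactum_has_disk_neighbourhoods (L : Set R2) (hL : IsCompact L)
    (hconn : IsConnected Lᶜ) :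
    ∀ V : Set R2, IsOpen V → L ⊆ V →
      ∃ E : Set R2, L ⊆ interior E ∧ E ⊆ V ∧
        ∃ (n : ℕ) (D : Fin n → Set R2),
          (∀ i, IsCompact (D i) ∧ Nonempty (↥(D i) ≃ₜ ↥(Metric.closedBall (0 : R2) 1))) ∧
          (Pairwise fun i j => Disjoint (D i) (D j)) ∧
          E = ⋃ i, D i := by
  intro V hV hLV
  let e := planeEquiv.toHomeomorph
  obtain ⟨E, hLE, hEV, hE⟩ := exists_isDiskUnion_of_isCompact (L := e '' L) (V := e '' V)
    (hL.image e.continuous) (by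
      rw [← image_compl_eq e.bijective]
      exact hconn.image _ e.continuous.continuousOn)
    (e.isOpenMap V hV) (image_mono hLV)
  refine ⟨e.symm '' E, ?_, ?_, hE.image e.symm⟩
  · rw [← e.symm.image_interior, e.image_symm]
    exact image_subset_iff.1 hLE
  · rw [e.image_symm, ← preimage_image_eq V e.injective]
    exact preimage_mono hEV
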